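/- arXiv:math/0510380 — 7 statements merged into one kernel-verified Lean document; each statement's English description precedes it below -/
import Mathlib

section
/- For every n ≥ 0, the map π defined by π(a, θ, f, g) = (a, θ_*(f_1, …, f_p, p+1+g_1, …, p+1+g_q)) — i.e. the sequence whose first entry is a and whose remaining n−1 entries are obtained by shuffling the sequence f with the sequence g shifted up by p+1 according to the (p,q)-shuffle θ — is a bijection from the disjoint union, over all p, q ≥ 0 with p + q = n − 1, of the sets {1, …, p+1} × Sh(p,q) × PF_p × PF_q onto PF_n. -/
/-- A parking function of length `n` is a sequence of positive integers
`(i_1, …, i_n)` such that its nondecreasing rearrangement `j_1 ≤ … ≤ j_n`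
satisfies `1 ≤ j_k ≤ k` for every `k`. -/
def IsParkingFunction {n : ℕ} (f : Fin n → ℕ) : Prop :=
  ∃ σ : Equiv.Perm (Fin n),
    Monotone (f ∘ σ) ∧ ∀ k : Fin n, 1 ≤ f (σ k) ∧ f (σ k) ≤ (k : ℕ) + 1

/-- A `(p,q)`-shuffle: a permutation of `{0, …, p+q-1}` that is increasing on
the first `p` indices and on the last `q` indices. -/
def IsShuffle (p q : ℕ) (θ : Equiv.Perm (Fin (p + q))) : Prop :=
  (∀ i j : Fin (p + q), (i : ℕ) < p → (j : ℕ) < p → i < j → θ i < θ j) ∧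
  (∀ i j : Fin (p + q), p ≤ (i : ℕ) → p ≤ (j : ℕ) → i < j → θ i < θ j)

/-- The concatenation `(f_1, …, f_p, p+1+g_1, …, p+1+g_q)`. -/
def concatShift (p q : ℕ) (f : Fin p → ℕ) (g : Fin q → ℕ) : Fin (p + q) → ℕ :=
  fun i => if h : (i : ℕ) < p then f ⟨i, h⟩
    else p + 1 + g ⟨(i : ℕ) - p, by have := i.isLt; omega⟩

/-- The sequence `(a, θ_*(f_1, …, f_p, p+1+g_1, …, p+1+g_q))`, where `θ_*(x)`
is the sequence whose `θ(i)`-th entry is `x_i`. -/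
def buildSeq (p q : ℕ) (a : ℕ) (θ : Equiv.Perm (Fin (p + q)))
    (f : Fin p → ℕ) (g : Fin q → ℕ) : Fin (p + q + 1) → ℕ :=
  Fin.cons a (concatShift p q f g ∘ θ.symm)

/-- The set of `(p,q)`-shuffles. -/
def Sh (p q : ℕ) := {θ : Equiv.Perm (Fin (p + q)) // IsShuffle p q θ}

/-- The set of parking functions of length `n`. -/
def PF (n : ℕ) := {f : Fin n → ℕ // IsParkingFunction f}

/-- The disjoint union, over `p, q ≥ 0` with `p + q = n - 1`, of the sets
`{1, …, p+1} × Sh(p,q) × PF_p × PF_q`. -/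
def PFDomain (n : ℕ) :=
  Σ pq : {pq : ℕ × ℕ // pq.1 + pq.2 + 1 = n},
    {a : ℕ // 1 ≤ a ∧ a ≤ pq.1.1 + 1} × Sh pq.1.1 pq.1.2 × PF pq.1.1 × PF pq.1.2

/-- The map `π(a, θ, f, g) = (a, θ_*(f_1, …, f_p, p+1+g_1, …, p+1+g_q))`. -/
def piMap (n : ℕ) (t : PFDomain n) : Fin n → ℕ := fun i =>
  buildSeq t.1.1.1 t.1.1.2 t.2.1.1 t.2.2.1.1 t.2.2.2.1.1 t.2.2.2.2.1
    (Fin.cast t.1.2.symm i)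

/-- Number of entries that are at most `k`. -/
def cntLE {n : ℕ} (f : Fin n → ℕ) (k : ℕ) : ℕ := ∑ i, if f i ≤ k then 1 else 0

theorem cntLE_card {n : ℕ} (f : Fin n → ℕ) (k : ℕ) :
    cntLE f k = (Finset.univ.filter fun i => f i ≤ k).card := by
  rw [cntLE, Finset.card_filter]

theorem cntLE_le {n : ℕ} (f : Fin n → ℕ) (k : ℕ) : cntLE f k ≤ n := by
  rw [cntLE_card]
  exact (Finset.card_le_univ _).trans (by simp)

theorem cntLE_mono {n : ℕ} (f : Fin n → ℕ) : Monotone (cntLE f) := by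
  intro a b h
  rw [cntLE_card, cntLE_card]
  apply Finset.card_le_card
  intro i
  simp only [Finset.mem_filter, Finset.mem_univ, true_and]
  omega

theorem pf_iff {n : ℕ} (f : Fin n → ℕ) :
    IsParkingFunction f ↔ (∀ i, 1 ≤ f i) ∧ ∀ k ≤ n, k ≤ cntLE f k := by
  constructor
  · rintro ⟨σ, -, h⟩
    refine ⟨fun i => by simpa using (h (σ.symm i)).1, fun k hk => ?_⟩
    rw [cntLE_card]
    have : (Finset.univ.map (Fin.castLEEmb hk |>.trans σ.toEmbedding)) ⊆
        Finset.univ.filter fun i => f i ≤ k := by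
      intro i
      simp only [Finset.mem_map, Finset.mem_univ, true_and, Finset.mem_filter]
      rintro ⟨j, rfl⟩
      have := (h (Fin.castLE hk j)).2
      have hj := j.isLt
      simp at this ⊢
      omega
    simpa using Finset.card_le_card this
  · rintro ⟨h1, h2⟩
    refine ⟨Tuple.sort f, Tuple.monotone_sort f, fun k => ⟨h1 _, ?_⟩⟩
    by_contra hlt
    have h3 := h2 (k + 1) k.isLt
    rw [cntLE_card] at h3
    have : (Finset.univ.filter fun i => f i ≤ (k : ℕ) + 1) ⊆
        (Finset.Iio k).map (Tuple.sort f).toEmbedding := by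
      intro i
      simp only [Finset.mem_map, Finset.mem_univ, true_and, Finset.mem_filter, Finset.mem_Iio]
      intro hi
      refine ⟨(Tuple.sort f).symm i, ?_, by simp⟩
      by_contra hk
      have := Tuple.monotone_sort f (not_lt.mp hk)
      simp at this
      omega
    have := Finset.card_le_card this
    simp at this
    omega

theorem concat_left (p q : ℕ) (f : Fin p → ℕ) (g : Fin q → ℕ) (i : Fin p) :
    concatShift p q f g (Fin.castAdd q i) = f i := by
  simp [concatShift]

theorem concat_right (p q : ℕ) (f : Fin p → ℕ) (g : Fin q → ℕ) (i : Fin q) :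
    concatShift p q f g (Fin.natAdd p i) = p + 1 + g i := by
  simp [concatShift]

theorem cntLE_concat (p q : ℕ) (f : Fin p → ℕ) (g : Fin q → ℕ) (θ : Equiv.Perm (Fin (p + q)))
    (k : ℕ) : cntLE (concatShift p q f g ∘ θ.symm) k =
      cntLE f k + cntLE (fun j => p + 1 + g j) k := by
  simp only [cntLE, Function.comp]
  rw [Equiv.sum_comp θ.symm (fun i => if concatShift p q f g i ≤ k then 1 else 0),
    Fin.sum_univ_add]
  simp only [concat_left, concat_right]

theorem cntLE_shift {q : ℕ} (c : ℕ) (g : Fin q → ℕ) (k : ℕ) :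
    cntLE (fun j => c + g j) (c + k) = cntLE g k := by
  simp [cntLE]

theorem cntLE_shift_zero {q : ℕ} (c : ℕ) (g : Fin q → ℕ) (k : ℕ) (h : k < c) :
    cntLE (fun j => c + g j) k = 0 := by
  simp only [cntLE]
  apply Finset.sum_eq_zero
  intro i _
  rw [if_neg]
  omega

theorem cntLE_cons {n : ℕ} (a : ℕ) (y : Fin n → ℕ) (k : ℕ) :
    cntLE (Fin.cons a y : Fin (n + 1) → ℕ) k = (if a ≤ k then 1 else 0) + cntLE y k := by
  simp only [cntLE, Fin.sum_univ_succ, Fin.cons_zero, Fin.cons_succ]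

theorem pf_le {n : ℕ} {f : Fin n → ℕ} (h : IsParkingFunction f) (i : Fin n) : f i ≤ n := by
  obtain ⟨σ, -, h⟩ := h
  have := (h (σ.symm i)).2
  simp at this
  have h2 := (σ.symm i).isLt
  omega

theorem cntLE_piMap (n : ℕ) (t : PFDomain n) (k : ℕ) :
    cntLE (piMap n t) k = (if t.2.1.1 ≤ k then 1 else 0) +
      (cntLE t.2.2.2.1.1 k + cntLE (fun j => t.1.1.1 + 1 + t.2.2.2.2.1 j) k) := by
  obtain ⟨⟨⟨p, q⟩, rfl⟩, a, θ, f, g⟩ := t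
  change cntLE (Fin.cons a.1 (concatShift p q f.1 g.1 ∘ θ.1.symm) : Fin (p + q + 1) → ℕ) k = _
  rw [cntLE_cons, cntLE_concat]

theorem piMap_zero (n : ℕ) (hn : 1 ≤ n) (t : PFDomain n) : piMap n t ⟨0, hn⟩ = t.2.1.1 := by
  obtain ⟨⟨⟨p, q⟩, rfl⟩, a, θ, f, g⟩ := t
  rfl

theorem piMap_maps (n : ℕ) (t : PFDomain n) : IsParkingFunction (piMap n t) := by
  rw [pf_iff]
  constructor
  · obtain ⟨⟨⟨p, q⟩, rfl⟩, a, θ, f, g⟩ := t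
    change ∀ i, 1 ≤ (Fin.cons a.1 (concatShift p q f.1 g.1 ∘ θ.1.symm) : Fin (p + q + 1) → ℕ) i
    intro i
    refine Fin.cases ?_ (fun i => ?_) i
    · simpa using a.2.1
    · simp only [Fin.cons_succ, Function.comp]
      generalize θ.1.symm i = j
      refine Fin.addCases (fun j => ?_) (fun j => ?_) j
      · rw [concat_left]
        exact ((pf_iff _).1 f.2).1 j
      · rw [concat_right]
        omega
  · intro k hk
    rw [cntLE_piMap]
    obtain ⟨⟨⟨p, q⟩, hpq⟩, a, θ, f, g⟩ := t
    have hf := ((pf_iff _).1 f.2).2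
    have hg := ((pf_iff _).1 g.2).2
    have ha := a.2
    dsimp only at *
    rcases Nat.lt_or_ge p k with h | h
    · obtain ⟨l, rfl⟩ := Nat.exists_eq_add_of_le h
      change _ ≤ _ + (_ + cntLE _ (p + 1 + l))
      rw [cntLE_shift, if_pos (by omega)]
      have h1 := hf p le_rfl
      have h2 := cntLE_mono f.1 (show p ≤ p + 1 + l by omega)
      have h3 := hg l (by omega)
      change p + 1 + l ≤ 1 + (cntLE f.1 (p + 1 + l) + _)
      omega
    · have := hf k h
      omega

theorem piMap_p_le (n : ℕ) (hn : 1 ≤ n) (t t' : PFDomain n) (h : piMap n t = piMap n t') :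
    t'.1.1.1 ≤ t.1.1.1 := by
  by_contra hlt
  have h1 := cntLE_piMap n t (t.1.1.1 + 1)
  have h2 := cntLE_piMap n t' (t.1.1.1 + 1)
  have h3 := piMap_zero n hn t
  have h4 := piMap_zero n hn t'
  rw [h] at h1 h3
  rw [← h3, cntLE_shift (t.1.1.1 + 1) _ 0] at h1
  rw [← h4] at h2
  have h5 : cntLE t.2.2.2.2.1 0 = 0 := by
    simp only [cntLE]
    apply Finset.sum_eq_zero
    intro i _
    have := ((pf_iff _).1 t.2.2.2.2.2).1 i
    rw [if_neg (by omega)]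
  have h6 := cntLE_le t.2.2.2.1.1 (t.1.1.1 + 1)
  have h7 := ((pf_iff _).1 t'.2.2.2.1.2).2 (t.1.1.1 + 1) (by omega)
  omega

theorem range_left (p q : ℕ) (f : Fin p → ℕ) (g : Fin q → ℕ) (hf : IsParkingFunction f)
    (θ : Equiv.Perm (Fin (p + q))) :
    Set.range (θ ∘ Fin.castAdd q) = {s | (concatShift p q f g ∘ θ.symm) s ≤ p} := by
  ext s
  obtain ⟨j, rfl⟩ := θ.surjective s
  simp only [Set.mem_range, Function.comp, Set.mem_ofPred_eq, Equiv.symm_apply_apply,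
    EmbeddingLike.apply_eq_iff_eq]
  refine Fin.addCases (fun j => ?_) (fun j => ?_) j
  · rw [concat_left]
    exact ⟨fun _ => pf_le hf j, fun _ => ⟨j, rfl⟩⟩
  · rw [concat_right]
    constructor
    · rintro ⟨i, hi⟩
      have := congrArg Fin.val hi
      have := i.isLt
      simp at *
      omega
    · intro
      omega

theorem range_right (p q : ℕ) (f : Fin p → ℕ) (g : Fin q → ℕ) (hf : IsParkingFunction f)
    (θ : Equiv.Perm (Fin (p + q))) :
    Set.range (θ ∘ Fin.natAdd p) = {s | ¬ (concatShift p q f g ∘ θ.symm) s ≤ p} := by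
  ext s
  obtain ⟨j, rfl⟩ := θ.surjective s
  simp only [Set.mem_range, Function.comp, Set.mem_ofPred_eq, Equiv.symm_apply_apply,
    EmbeddingLike.apply_eq_iff_eq]
  refine Fin.addCases (fun j => ?_) (fun j => ?_) j
  · rw [concat_left]
    constructor
    · rintro ⟨i, hi⟩
      have := congrArg Fin.val hi
      have := j.isLt
      simp at *
      omega
    · intro h
      exact absurd (pf_le hf j) h
  · rw [concat_right]
    exact ⟨fun _ => by omega, fun _ => ⟨j, rfl⟩⟩

theorem piMap_inj (n : ℕ) (hn : 1 ≤ n) (t t' : PFDomain n) (h : piMap n t = piMap n t') :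
    t = t' := by
  have hp : t.1.1.1 = t'.1.1.1 :=
    le_antisymm (piMap_p_le n hn t' t h.symm) (piMap_p_le n hn t t' h)
  obtain ⟨⟨⟨p, q⟩, rfl⟩, a, θ, f, g⟩ := t
  obtain ⟨⟨⟨p', q'⟩, hq⟩, a', θ', f', g'⟩ := t'
  dsimp only at hp
  subst hp
  have hq' : q' = q := by
    dsimp only at hq
    omega
  subst hq'
  change (Fin.cons a.1 (concatShift p q' f.1 g.1 ∘ θ.1.symm) : Fin (p + q' + 1) → ℕ) =
    Fin.cons a'.1 (concatShift p q' f'.1 g'.1 ∘ θ'.1.symm) at h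
  obtain ⟨ha, hy⟩ := Fin.cons_inj.1 h
  have hl : θ.1 ∘ Fin.castAdd q' = θ'.1 ∘ Fin.castAdd q' := by
    refine (StrictMono.range_inj ?_ ?_).1 ?_
    · exact fun i j hij => θ.2.1 _ _ i.isLt j.isLt hij
    · exact fun i j hij => θ'.2.1 _ _ i.isLt j.isLt hij
    · rw [range_left p q' f.1 g.1 f.2, range_left p q' f'.1 g'.1 f'.2, hy]
  have hr : θ.1 ∘ Fin.natAdd p = θ'.1 ∘ Fin.natAdd p := by
    refine (StrictMono.range_inj ?_ ?_).1 ?_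
    · exact fun i j hij => θ.2.2 _ _ (by simp) (by simp) (by simpa using hij)
    · exact fun i j hij => θ'.2.2 _ _ (by simp) (by simp) (by simpa using hij)
    · rw [range_right p q' f.1 g.1 f.2, range_right p q' f'.1 g'.1 f'.2, hy]
  have hθ : θ = θ' := by
    apply Subtype.ext
    ext1 j
    refine Fin.addCases (fun j => ?_) (fun j => ?_) j
    · exact congrFun hl j
    · exact congrFun hr j
  subst hθ
  have hc : concatShift p q' f.1 g.1 = concatShift p q' f'.1 g'.1 := by
    funext j
    simpa using congrFun hy (θ.1 j)
  have hf : f = f' := by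
    apply Subtype.ext
    funext i
    simpa [concat_left] using congrFun hc (Fin.castAdd q' i)
  have hg : g = g' := by
    apply Subtype.ext
    funext i
    simpa [concat_right] using congrFun hc (Fin.natAdd p i)
  have ha' : a = a' := Subtype.ext ha
  subst hf hg ha'
  rfl

theorem exists_shuffle (p q : ℕ) (S : Finset (Fin (p + q))) (hS : S.card = p) :
    ∃ θ : Equiv.Perm (Fin (p + q)), IsShuffle p q θ ∧
      (∀ i : Fin p, θ (Fin.castAdd q i) ∈ S) ∧ ∀ i : Fin q, θ (Fin.natAdd p i) ∉ S := by
  have hS' : Sᶜ.card = q := by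
    rw [Finset.card_compl, hS]
    simp
  have hl : ∀ i, (finSumFinEquiv.symm.trans (finSumEquivOfFinset hS hS')) (Fin.castAdd q i)
      = S.orderEmbOfFin hS i := by
    intro i
    simp
  have hr : ∀ i, (finSumFinEquiv.symm.trans (finSumEquivOfFinset hS hS')) (Fin.natAdd p i)
      = Sᶜ.orderEmbOfFin hS' i := by
    intro i
    simp
  refine ⟨finSumFinEquiv.symm.trans (finSumEquivOfFinset hS hS'), ⟨?_, ?_⟩, ?_, ?_⟩
  · intro i j
    refine Fin.addCases (fun i => ?_) (fun i => ?_) i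
    · refine Fin.addCases (fun j => ?_) (fun j => ?_) j
      · intro _ _ hij
        rw [hl, hl]
        exact (S.orderEmbOfFin hS).strictMono hij
      · intro _ h
        simp at h
    · intro h
      simp at h
  · intro i j
    refine Fin.addCases (fun i => ?_) (fun i => ?_) i
    · intro h
      have := i.isLt
      simp at h
      omega
    · refine Fin.addCases (fun j => ?_) (fun j => ?_) j
      · intro _ h
        have := j.isLt
        simp at h
        omega
      · intro _ _ hij
        rw [hr, hr]
        exact (Sᶜ.orderEmbOfFin hS').strictMono (by simpa using hij)
  · intro i
    rw [hl]
    exact Finset.orderEmbOfFin_mem _ _ _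
  · intro i
    rw [hr]
    exact Finset.mem_compl.1 (Finset.orderEmbOfFin_mem _ _ _)

theorem piMap_surj_aux (p q : ℕ) (a : ℕ) (y : Fin (p + q) → ℕ)
    (hx : IsParkingFunction (Fin.cons a y : Fin (p + q + 1) → ℕ))
    (h1 : cntLE y (p + 1) ≤ p) (h2 : ∀ k ≤ p, k ≤ cntLE y k) :
    ∃ t, piMap (p + q + 1) t = Fin.cons a y := by
  obtain ⟨hpos, hcnt⟩ := (pf_iff _).1 hx
  have ha1 : 1 ≤ a := hpos 0
  have hy1 : ∀ i, 1 ≤ y i := fun i => hpos i.succ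
  simp only [cntLE_cons] at hcnt
  have hap : a ≤ p + 1 := by
    by_contra hlt
    have := hcnt (p + 1) (by omega)
    rw [if_neg hlt] at this
    omega
  have hmono := cntLE_mono y (show p ≤ p + 1 by omega)
  have hcp : cntLE y p = p := by
    have := h2 p le_rfl
    omega
  have hcp1 : cntLE y (p + 1) = p := by omega
  have hne : ∀ i, p < y i → p + 2 ≤ y i := by
    intro i hi
    have hsub : (Finset.univ.filter fun i => y i ≤ p) =
        Finset.univ.filter fun i => y i ≤ p + 1 := by
      apply Finset.eq_of_subset_of_card_le
      · intro i
        simp only [Finset.mem_filter, Finset.mem_univ, true_and]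
        omega
      · rw [← cntLE_card, ← cntLE_card, hcp, hcp1]
    have := Finset.ext_iff.1 hsub i
    simp only [Finset.mem_filter, Finset.mem_univ, true_and] at this
    omega
  obtain ⟨θ, hθ, hl, hr⟩ := exists_shuffle p q (Finset.univ.filter fun i => y i ≤ p)
    (by rw [← cntLE_card, hcp])
  simp only [Finset.mem_filter, Finset.mem_univ, true_and, not_le] at hl hr
  set f : Fin p → ℕ := fun i => y (θ (Fin.castAdd q i)) with hf
  set g : Fin q → ℕ := fun i => y (θ (Fin.natAdd p i)) - (p + 1) with hg
  have hyc : concatShift p q f g ∘ θ.symm = y := by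
    funext s
    obtain ⟨j, rfl⟩ := θ.surjective s
    simp only [Function.comp, Equiv.symm_apply_apply]
    refine Fin.addCases (fun j => ?_) (fun j => ?_) j
    · rw [concat_left]
    · rw [concat_right]
      have := hr j
      simp only [hg]
      omega
  have hc := cntLE_concat p q f g θ
  rw [hyc] at hc
  have hfp : IsParkingFunction f := by
    rw [pf_iff]
    refine ⟨fun i => hy1 _, fun k hk => ?_⟩
    have h3 := hc k
    rw [cntLE_shift_zero _ _ _ (by omega)] at h3
    have := h2 k hk
    omega
  have hgp : IsParkingFunction g := by
    rw [pf_iff]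
    refine ⟨fun i => ?_, fun k hk => ?_⟩
    · have := hne _ (hr i)
      simp only [hg]
      omega
    · have h3 := hc (p + 1 + k)
      rw [cntLE_shift] at h3
      have h4 := hcnt (p + 1 + k) (by omega)
      rw [if_pos (by omega)] at h4
      have h5 := cntLE_le f (p + 1 + k)
      omega
  refine ⟨⟨⟨(p, q), rfl⟩, ⟨a, ha1, hap⟩, ⟨θ, hθ⟩, ⟨f, hfp⟩, ⟨g, hgp⟩⟩, ?_⟩
  change (Fin.cons a (concatShift p q f g ∘ θ.symm) : Fin (p + q + 1) → ℕ) = _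
  rw [hyc]

theorem piMap_surj (m : ℕ) (x : Fin (m + 1) → ℕ) (hx : IsParkingFunction x) :
    ∃ t, piMap (m + 1) t = x := by
  have hex : ∃ p, cntLE (Fin.tail x) (p + 1) ≤ p := ⟨m, cntLE_le _ _⟩
  classical
  have h1 := Nat.find_spec hex
  have h2 : ∀ k ≤ Nat.find hex, k ≤ cntLE (Fin.tail x) k := by
    intro k hk
    rcases k with _ | k
    · omega
    · have := Nat.find_min hex (show k < _ by omega)
      omega
  have h3 : Nat.find hex ≤ m := Nat.find_min' hex (cntLE_le _ _)
  generalize Nat.find hex = p at h1 h2 h3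
  obtain ⟨q, rfl⟩ := Nat.exists_eq_add_of_le h3
  rw [← Fin.cons_self_tail x] at hx ⊢
  exact piMap_surj_aux p q _ _ hx (by simpa using h1) (by simpa using h2)

/-- for every `n ≥ 1`, the map `π` is a bijection from the
disjoint union of the sets `{1, …, p+1} × Sh(p,q) × PF_p × PF_q`
(over `p + q = n - 1`) onto the set of parking functions of length `n`. -/
theorem piMap_bijective (n : ℕ) (hn : 1 ≤ n) :
    Set.BijOn (piMap n) Set.univ {x : Fin n → ℕ | IsParkingFunction x} := by
  refine ⟨fun t _ => piMap_maps n t, fun t _ t' _ h => piMap_inj n hn t t' h, ?_⟩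
  intro x hx
  obtain ⟨m, rfl⟩ := Nat.exists_eq_add_of_le' hn
  obtain ⟨t, ht⟩ := piMap_surj m x hx
  exact ⟨t, Set.mem_univ _, ht⟩
end

section
/- Let p, q ≥ 0 and n = p + q + 1. For every a with 1 ≤ a ≤ p+1, every (p,q)-shuffle θ, every parking function f of length p, and every parking function g of length q, the sequence (a, θ_*(f_1, …, f_p, p+1+g_1, …, p+1+g_q)) is a parking function of length n. -/
theorem parking_of_rank {n : ℕ} (h : Fin n → ℕ) (r : Fin n → Fin n)
    (hr : Function.Injective r) (h1 : ∀ i, 1 ≤ h i) (h2 : ∀ i, h i ≤ (r i : ℕ) + 1) :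
    IsParkingFunction h := by
  refine ⟨Tuple.sort h, Tuple.monotone_sort h, fun k => ⟨h1 _, ?_⟩⟩
  by_contra hk
  have hk : (k : ℕ) + 1 < h (Tuple.sort h k) := not_le.mp hk
  have hm : Monotone (h ∘ Tuple.sort h) := Tuple.monotone_sort h
  -- the map from indices `j ≥ k` to ranks lands in the ranks `> k`
  have hc : (Finset.Ici k).card ≤ (Finset.Ioi k).card := by
    refine Finset.card_le_card_of_injOn (fun j => r (Tuple.sort h j)) ?_ ?_
    · intro j hj
      have hj : k ≤ j := by simpa using hj
      have e1 : h (Tuple.sort h k) ≤ h (Tuple.sort h j) := hm hj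
      have e2 := h2 (Tuple.sort h j)
      simp only [Finset.coe_Ioi, Set.mem_Ioi, Fin.lt_def]
      omega
    · exact (hr.comp (Tuple.sort h).injective).injOn
  simp only [Fin.card_Ici, Fin.card_Ioi] at hc
  omega

/-- for `1 ≤ a ≤ p+1`, a `(p,q)`-shuffle `θ`, parking functions
`f ∈ PF_p` and `g ∈ PF_q`, the sequence `(a, θ_*(f, p+1+g))` is a parking
function of length `n = p + q + 1`. -/
theorem buildSeq_isParkingFunction (p q : ℕ) (a : ℕ) (ha : 1 ≤ a) (ha' : a ≤ p + 1)
    (θ : Equiv.Perm (Fin (p + q))) (hθ : IsShuffle p q θ)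
    (f : Fin p → ℕ) (hf : IsParkingFunction f)
    (g : Fin q → ℕ) (hg : IsParkingFunction g) :
    IsParkingFunction (buildSeq p q a θ f g) := by
  obtain ⟨σ, -, hσ⟩ := hf
  obtain ⟨τ, -, hτ⟩ := hg
  have hf1 : ∀ i, 1 ≤ f i ∧ f i ≤ (σ.symm i : ℕ) + 1 := fun i => by
    simpa using hσ (σ.symm i)
  have hg1 : ∀ i, 1 ≤ g i ∧ g i ≤ (τ.symm i : ℕ) + 1 := fun i => by
    simpa using hτ (τ.symm i)
  let s : Fin (p + q) → Fin (p + q + 1) := fun i =>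
    if h : (i : ℕ) < p then ⟨σ.symm ⟨i, h⟩, by omega⟩
    else ⟨p + 1 + τ.symm ⟨(i : ℕ) - p, by omega⟩, by omega⟩
  have hs : Function.Injective s := by
    intro i j hij
    simp only [s] at hij
    split_ifs at hij with h h' h' <;> simp only [Fin.mk.injEq] at hij
    · have := σ.symm.injective (Fin.ext hij)
      simp only [Fin.mk.injEq] at this
      exact Fin.ext this
    · omega
    · omega
    · have := τ.symm.injective (Fin.ext (Nat.add_left_cancel hij))
      simp only [Fin.mk.injEq] at this
      exact Fin.ext (by omega)
  have hsp : ∀ i, s i ≠ ⟨p, by omega⟩ := by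
    intro i hi
    simp only [s] at hi
    split_ifs at hi with h <;> simp only [Fin.mk.injEq] at hi <;> omega
  have hb : ∀ i, 1 ≤ concatShift p q f g i ∧ concatShift p q f g i ≤ (s i : ℕ) + 1 := by
    intro i
    simp only [concatShift, s]
    split_ifs with h
    · exact hf1 _
    · have := hg1 ⟨(i : ℕ) - p, by omega⟩
      constructor
      · omega
      · simp only
        omega
  refine parking_of_rank _ (Fin.cons ⟨p, by omega⟩ (s ∘ θ.symm)) ?_ ?_ ?_
  · rw [Fin.cons_injective_iff]
    refine ⟨?_, hs.comp θ.symm.injective⟩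
    rintro ⟨i, hi⟩
    exact hsp _ hi
  · intro i
    refine Fin.cases ?_ (fun i => ?_) i
    · simpa [buildSeq] using ha
    · simpa [buildSeq] using (hb (θ.symm i)).1
  · intro i
    refine Fin.cases ?_ (fun i => ?_) i
    · simpa [buildSeq] using ha'
    · simpa [buildSeq] using (hb (θ.symm i)).2
end

section
/- For every n ≥ 1, the number of parking functions of length n satisfies the recursion #PF_n = Σ_{p=0}^{n-1} (p+1) · binom(n−1, p) · #PF_p · #PF_{n−1−p}, where #PF_0 = 1. -/
def pfCnt {α : Type} [Fintype α] (f : α → ℕ) (k : ℕ) : ℕ := ∑ i, if f i ≤ k then 1 else 0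

def GenPF {α : Type} [Fintype α] (f : α → ℕ) : Prop :=
  (∀ i, 1 ≤ f i) ∧ ∀ k ≤ Fintype.card α, k ≤ pfCnt f k

theorem GenPF.le_card {α : Type} [Fintype α] {f : α → ℕ} (h : GenPF f) (i : α) :
    f i ≤ Fintype.card α := by
  by_contra hi
  have h1 := h.2 _ le_rfl
  have h2 : pfCnt f (Fintype.card α) < ∑ _i : α, 1 := by
    unfold pfCnt
    refine Finset.sum_lt_sum (fun j _ => by split_ifs <;> simp) ⟨i, Finset.mem_univ _, ?_⟩
    rw [if_neg hi]; exact Nat.one_pos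
  simp at h2
  omega

theorem pfCnt_comp {α β : Type} [Fintype α] [Fintype β] (e : α ≃ β) (f : β → ℕ) (k : ℕ) :
    pfCnt (f ∘ e) k = pfCnt f k := by
  unfold pfCnt
  exact Equiv.sum_comp e (fun i => if f i ≤ k then 1 else 0)

theorem genPF_comp {α β : Type} [Fintype α] [Fintype β] (e : α ≃ β) (f : β → ℕ) :
    GenPF (f ∘ e) ↔ GenPF f := by
  unfold GenPF
  simp only [pfCnt_comp, Fintype.card_congr e]
  refine and_congr ?_ Iff.rfl
  exact e.forall_congr_left.trans (by simp)

theorem pfCnt_lt (n k : ℕ) (hk : k ≤ n) : pfCnt (fun j : Fin n => (j : ℕ) + 1) k = k := by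
  unfold pfCnt
  rw [Fin.sum_univ_eq_sum_range (fun j => if j + 1 ≤ k then 1 else 0) n, ← Finset.card_filter]
  have : Finset.filter (fun j => j + 1 ≤ k) (Finset.range n) = Finset.range k := by
    ext j; simp; omega
  rw [this, Finset.card_range]

theorem isPF_iff {n : ℕ} (f : Fin n → ℕ) : IsParkingFunction f ↔ GenPF f := by
  constructor
  · rintro ⟨σ, -, h⟩
    rw [← genPF_comp σ]
    refine ⟨fun i => (h i).1, fun k hk => ?_⟩
    rw [Fintype.card_fin] at hk
    conv_lhs => rw [← pfCnt_lt n k hk]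
    unfold pfCnt
    refine Finset.sum_le_sum fun j _ => ?_
    have := (h j).2
    simp only [Function.comp]
    split_ifs <;> omega
  · intro h
    refine ⟨Tuple.sort f, Tuple.monotone_sort f, fun k => ⟨h.1 _, ?_⟩⟩
    by_contra hk
    have h1 := ((genPF_comp (Tuple.sort f) f).2 h).2 (k + 1) (by simp)
    have h2 : pfCnt (f ∘ Tuple.sort f) (k + 1) ≤ k := by
      conv_rhs => rw [← pfCnt_lt n k (by omega)]
      unfold pfCnt
      refine Finset.sum_le_sum fun j _ => ?_
      have hm : k ≤ j → _ := fun hj => Tuple.monotone_sort f hj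
      simp only [Function.comp, Fin.le_def] at hm ⊢
      split_ifs with h3 h4 <;> grind
    omega

instance genPF_finite (α : Type) [Fintype α] : Finite {f : α → ℕ // GenPF f} := by
  refine Finite.of_injective
    (fun f => fun i : α => (⟨f.1 i, Nat.lt_succ_of_le (f.2.le_card i)⟩ :
      Fin (Fintype.card α + 1))) ?_
  intro f g h
  ext i
  have := congrFun h i
  simpa using this

theorem card_genPF (α : Type) [Fintype α] (n : ℕ) (h : Fintype.card α = n) :
    Nat.card {f : α → ℕ // GenPF f} = Nat.card {f : Fin n → ℕ // IsParkingFunction f} := by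
  refine Nat.card_congr ?_
  let e := Fintype.equivFinOfCardEq h
  refine Equiv.subtypeEquiv (Equiv.arrowCongr e (Equiv.refl ℕ)) fun f => ?_
  rw [isPF_iff]
  exact (genPF_comp e.symm f).symm

/-- gluing -/
def pfGlue {m : ℕ} (S : Finset (Fin m)) (g : {x // x ∈ S} → ℕ) (h : {x // x ∈ Sᶜ} → ℕ) :
    Fin m → ℕ :=
  fun i => if hi : i ∈ S then g ⟨i, hi⟩ else h ⟨i, Finset.mem_compl.2 hi⟩ + S.card + 1

theorem pfGlue_mem {m : ℕ} (S : Finset (Fin m)) (g : {x // x ∈ S} → ℕ) (h : {x // x ∈ Sᶜ} → ℕ)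
    (i : {x // x ∈ S}) : pfGlue S g h i = g i := by simp [pfGlue]

theorem pfGlue_not_mem {m : ℕ} (S : Finset (Fin m)) (g : {x // x ∈ S} → ℕ)
    (h : {x // x ∈ Sᶜ} → ℕ) (i : {x // x ∈ Sᶜ}) : pfGlue S g h i = h i + S.card + 1 := by
  have := Finset.mem_compl.1 i.2
  simp [pfGlue, this]

theorem pfCnt_split {m : ℕ} (S : Finset (Fin m)) (G : Fin m → ℕ) (k : ℕ) :
    pfCnt G k = pfCnt (fun i : {x // x ∈ S} => G i) k
      + pfCnt (fun i : {x // x ∈ Sᶜ} => G i) k := by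
  unfold pfCnt
  rw [Finset.sum_coe_sort S (fun i => if G i ≤ k then 1 else 0),
    Finset.sum_coe_sort Sᶜ (fun i => if G i ≤ k then 1 else 0), Finset.sum_add_sum_compl]

theorem pfCnt_succ {m : ℕ} (F : Fin (m + 1) → ℕ) (k : ℕ) :
    pfCnt F k = (if F 0 ≤ k then 1 else 0) + pfCnt (fun i : Fin m => F i.succ) k := by
  unfold pfCnt
  rw [Fin.sum_univ_succ]

theorem pfCnt_mono {α : Type} [Fintype α] (f : α → ℕ) {k l : ℕ} (h : k ≤ l) :
    pfCnt f k ≤ pfCnt f l := by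
  unfold pfCnt
  refine Finset.sum_le_sum fun j _ => ?_
  split_ifs <;> omega

theorem pfCnt_all {α : Type} [Fintype α] (f : α → ℕ) {k : ℕ} (h : ∀ i, f i ≤ k) :
    pfCnt f k = Fintype.card α := by
  simp [pfCnt, h]

theorem pfCnt_none {α : Type} [Fintype α] (f : α → ℕ) {k : ℕ} (h : ∀ i, k < f i) :
    pfCnt f k = 0 := by
  simp [pfCnt, h]

theorem pfCnt_le {α : Type} [Fintype α] (f : α → ℕ) (k : ℕ) :
    pfCnt f k ≤ Fintype.card α := by
  rw [← pfCnt_all (fun _ : α => 0) (k := 0) (by simp)]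
  unfold pfCnt
  refine Finset.sum_le_sum fun j _ => ?_
  simp only [le_refl, if_true]
  split_ifs <;> omega

theorem pfCnt_shift {α : Type} [Fintype α] (f : α → ℕ) (k c : ℕ) :
    pfCnt (fun i => f i + c) (k + c) = pfCnt f k := by
  simp [pfCnt]

theorem pfCnt_glue {m : ℕ} (S : Finset (Fin m)) (g : {x // x ∈ S} → ℕ)
    (h : {x // x ∈ Sᶜ} → ℕ) (k : ℕ) :
    pfCnt (pfGlue S g h) k = pfCnt g k + pfCnt (fun i => h i + (S.card + 1)) k := by
  rw [pfCnt_split S]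
  simp only [pfGlue_mem, pfGlue_not_mem, add_assoc]

theorem glue_genPF {m : ℕ} (S : Finset (Fin m)) (g : {x // x ∈ S} → ℕ)
    (h : {x // x ∈ Sᶜ} → ℕ) (hg : GenPF g) (hh : GenPF h) (a : Fin (S.card + 1)) :
    GenPF (Fin.cons ((a : ℕ) + 1) (pfGlue S g h) : Fin (m + 1) → ℕ) := by
  have hS : Fintype.card {x // x ∈ S} = S.card := Fintype.card_coe S
  have hSc : Fintype.card {x // x ∈ Sᶜ} = m - S.card := by
    rw [Fintype.card_coe, Finset.card_compl, Fintype.card_fin]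
  constructor
  · intro i
    refine Fin.cases ?_ (fun i => ?_) i
    · simp
    · simp only [Fin.cons_succ, pfGlue]
      split_ifs
      · exact hg.1 _
      · omega
  · intro k hk
    rw [Fintype.card_fin] at hk
    rw [pfCnt_succ]
    simp only [Fin.cons_zero, Fin.cons_succ]
    have e := pfCnt_glue S g h k
    change k ≤ _ + pfCnt (pfGlue S g h) k
    rw [e]
    by_cases hkS : k ≤ S.card
    · have := hg.2 k (by omega)
      omega
    · obtain ⟨j, rfl⟩ : ∃ j, k = j + (S.card + 1) := ⟨k - (S.card + 1), by omega⟩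
      rw [pfCnt_shift, pfCnt_all g (fun i => (hg.le_card i).trans (by omega)), hS,
        if_pos (by omega)]
      have := hh.2 j (by omega)
      omega

abbrev PFData (m : ℕ) : Type :=
  Σ S : Finset (Fin m), ({g : {x // x ∈ S} → ℕ // GenPF g} ×
    {h : {x // x ∈ Sᶜ} → ℕ // GenPF h}) × Fin (S.card + 1)

def pfMap (m : ℕ) (d : PFData m) : {F : Fin (m + 1) → ℕ // GenPF F} :=
  ⟨_, glue_genPF d.1 d.2.1.1.1 d.2.1.2.1 d.2.1.1.2 d.2.1.2.2 d.2.2⟩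

theorem glue_card_le {m : ℕ} (S T : Finset (Fin m)) (g : {x // x ∈ S} → ℕ)
    (h : {x // x ∈ Sᶜ} → ℕ) (g' : {x // x ∈ T} → ℕ)
    (h' : {x // x ∈ Tᶜ} → ℕ) (hh : GenPF h) (hg' : GenPF g')
    (e : pfGlue S g h = pfGlue T g' h') : T.card ≤ S.card := by
  by_contra hlt
  have h1 := pfCnt_glue S g h (S.card + 1)
  have h2 := pfCnt_glue T g' h' (S.card + 1)
  have h3 := hg'.2 (S.card + 1) (by rw [Fintype.card_coe]; omega)
  rw [pfCnt_none (fun i => h i + (S.card + 1)) (fun i => by have := hh.1 i; omega)] at h1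
  have h4 := pfCnt_le g (S.card + 1)
  rw [Fintype.card_coe] at h4
  rw [e] at h1
  omega

theorem glue_mem_iff {m : ℕ} (S : Finset (Fin m)) (g : {x // x ∈ S} → ℕ)
    (h : {x // x ∈ Sᶜ} → ℕ) (hg : GenPF g) (i : Fin m) :
    i ∈ S ↔ pfGlue S g h i ≤ S.card := by
  unfold pfGlue
  split_ifs with hi
  · have := hg.le_card ⟨i, hi⟩
    rw [Fintype.card_coe] at this
    simp [hi, this]
  · simp only [hi, false_iff]
    omega

theorem pfMap_injective (m : ℕ) : Function.Injective (pfMap m) := by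
  rintro ⟨S, ⟨⟨g, hg⟩, ⟨h, hh⟩⟩, a⟩ ⟨T, ⟨⟨g', hg'⟩, ⟨h', hh'⟩⟩, b⟩ e
  have e := congrArg Subtype.val e
  simp only [pfMap] at e
  obtain ⟨e1, e2⟩ := Fin.cons_injective2 e
  have hc : S.card = T.card :=
    le_antisymm (glue_card_le T S g' h' g h hh' hg e2.symm) (glue_card_le S T g h g' h' hh hg' e2)
  have hST : S = T := by
    ext i
    rw [glue_mem_iff S g h hg, glue_mem_iff T g' h' hg', e2, hc]
  subst hST
  have hgg : g = g' := by
    funext i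
    rw [← pfGlue_mem S g h, e2, pfGlue_mem]
  have hhh : h = h' := by
    funext i
    have h1 := pfGlue_not_mem S g h i
    have h2 := pfGlue_not_mem S g' h' i
    rw [e2] at h1
    omega
  have hab : a = b := by ext; omega
  subst hgg hhh hab
  rfl

theorem pfMap_surjective (m : ℕ) : Function.Surjective (pfMap m) := by
  rintro ⟨F, hF⟩
  have hFc : ∀ k ≤ m + 1, k ≤ pfCnt F k := fun k hk => hF.2 k (by simpa using hk)
  obtain ⟨G, hG⟩ : ∃ G : Fin m → ℕ, G = fun i => F i.succ := ⟨_, rfl⟩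
  have hsucc : ∀ k, pfCnt F k = (if F 0 ≤ k then 1 else 0) + pfCnt G k := by
    intro k; rw [pfCnt_succ, hG]
  have hGm : ∀ k, pfCnt G k ≤ m := fun k => by simpa using pfCnt_le G k
  have hex : ∃ p, pfCnt G (p + 1) < p + 1 := ⟨m, by have := hGm (m + 1); omega⟩
  classical
  obtain ⟨p, hp1, hp2⟩ : ∃ p, pfCnt G (p + 1) < p + 1 ∧ ∀ k ≤ p, k ≤ pfCnt G k := by
    refine ⟨Nat.find hex, Nat.find_spec hex, fun k hk => ?_⟩
    rcases k with _ | k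
    · exact Nat.zero_le _
    · have := Nat.find_min hex (m := k) (by omega)
      omega
  have hpm : p ≤ m := (hp2 p le_rfl).trans (hGm p)
  have hm1 := pfCnt_mono G (Nat.le_succ p)
  have hpp := hp2 p le_rfl
  have hcp : pfCnt G p = p := by simp only [Nat.succ_eq_add_one] at hm1; omega
  have hne : ∀ i, G i ≠ p + 1 := by
    intro i hi
    have : pfCnt G p < pfCnt G (p + 1) := by
      unfold pfCnt
      refine Finset.sum_lt_sum (fun j _ => by split_ifs <;> omega) ⟨i, Finset.mem_univ _, ?_⟩
      rw [if_neg (by omega), if_pos (by omega)]; exact Nat.one_pos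
    omega
  have ha : F 0 ≤ p + 1 := by
    by_contra h
    have h1 := hsucc (p + 1)
    rw [if_neg h] at h1
    have := hFc (p + 1) (by omega)
    omega
  obtain ⟨S, hS⟩ : ∃ S : Finset (Fin m), S = Finset.univ.filter (fun i => G i ≤ p) := ⟨_, rfl⟩
  have hSm : ∀ i, i ∈ S ↔ G i ≤ p := by simp [hS]
  have hScard : S.card = p := by
    rw [hS, Finset.card_filter]; exact hcp
  have hSc : Fintype.card {x // x ∈ Sᶜ} = m - p := by
    rw [Fintype.card_coe, Finset.card_compl, Fintype.card_fin, hScard]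
  have hbig : ∀ i : {x // x ∈ Sᶜ}, p + 1 < G i := by
    intro i
    have h1 := Finset.mem_compl.1 i.2
    rw [hSm] at h1
    have := hne i
    omega
  have hg : GenPF (fun i : {x // x ∈ S} => G i) := by
    refine ⟨fun i => by rw [hG]; exact hF.1 _, fun k hk => ?_⟩
    rw [Fintype.card_coe, hScard] at hk
    have h1 := pfCnt_split S G k
    rw [pfCnt_none (fun i : {x // x ∈ Sᶜ} => G i) (fun i => by have := hbig i; omega)] at h1
    have := hp2 k hk
    omega
  have hh : GenPF (fun i : {x // x ∈ Sᶜ} => G i - (p + 1)) := by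
    refine ⟨fun i => by have := hbig i; simp only; omega, fun k hk => ?_⟩
    rw [hSc] at hk
    have h1 := pfCnt_split S G (k + (p + 1))
    rw [pfCnt_all (fun i : {x // x ∈ S} => G i)
      (fun i => by have := (hSm i).1 i.2; omega), Fintype.card_coe, hScard] at h1
    have h2 := pfCnt_shift (fun i : {x // x ∈ Sᶜ} => G i - (p + 1)) k (p + 1)
    have h3 : (fun i : {x // x ∈ Sᶜ} => G i - (p + 1) + (p + 1)) = fun i : {x // x ∈ Sᶜ} => G i := by
      funext i; have := hbig i; omega
    rw [h3] at h2
    have h4 := hsucc (k + (p + 1))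
    rw [if_pos (by omega)] at h4
    have := hFc (k + (p + 1)) (by omega)
    omega
  have hF0 := hF.1 0
  refine ⟨⟨S, ⟨⟨_, hg⟩, ⟨_, hh⟩⟩, ⟨F 0 - 1, by omega⟩⟩, ?_⟩
  apply Subtype.ext
  simp only [pfMap]
  funext i
  refine Fin.cases ?_ (fun i => ?_) i
  · simp only [Fin.cons_zero]; omega
  · simp only [Fin.cons_succ]
    have hGi : F i.succ = G i := by rw [hG]
    rw [hGi]
    unfold pfGlue
    split_ifs with hi
    · rfl
    · have := hbig ⟨i, Finset.mem_compl.2 hi⟩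
      simp only at this ⊢
      omega

/-- for every `n ≥ 1`, the number of parking functions of length
`n` satisfies `#PF_n = Σ_{p=0}^{n-1} (p+1) · binom(n−1,p) · #PF_p · #PF_{n−1−p}`. -/
theorem card_parkingFunction_recursion (n : ℕ) (hn : 1 ≤ n) :
    Nat.card {f : Fin n → ℕ // IsParkingFunction f} =
      ∑ p ∈ Finset.range n,
        (p + 1) * Nat.choose (n - 1) p *
          Nat.card {f : Fin p → ℕ // IsParkingFunction f} *
          Nat.card {f : Fin (n - 1 - p) → ℕ // IsParkingFunction f} := by
  obtain ⟨m, rfl⟩ : ∃ m, n = m + 1 := ⟨n - 1, by omega⟩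
  simp only [Nat.add_sub_cancel]
  rw [← card_genPF (Fin (m + 1)) (m + 1) (Fintype.card_fin _),
    ← Nat.card_congr (Equiv.ofBijective (pfMap m) ⟨pfMap_injective m, pfMap_surjective m⟩),
    Nat.card_sigma]
  have key := Finset.sum_powerset_apply_card (x := (Finset.univ : Finset (Fin m))) (fun p => (p + 1) *
          Nat.card {f : Fin p → ℕ // IsParkingFunction f} *
          Nat.card {f : Fin (m - p) → ℕ // IsParkingFunction f})
  rw [Finset.powerset_univ, Finset.card_univ, Fintype.card_fin] at key
  refine Eq.trans (Finset.sum_congr rfl fun S _ => ?_) (key.trans ?_)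
  · rw [Nat.card_prod, Nat.card_prod, card_genPF _ S.card (Fintype.card_coe S),
      card_genPF _ (m - S.card)
        (by rw [Fintype.card_coe, Finset.card_compl, Fintype.card_fin]), Nat.card_fin]
    ring
  · refine Finset.sum_congr rfl fun p _ => ?_
    rw [smul_eq_mul]
    change _ = (p + 1) * Nat.choose m p * Nat.card {f : Fin p → ℕ // IsParkingFunction f} *
      Nat.card {f : Fin (m - p) → ℕ // IsParkingFunction f}
    ring
end

section
/- For every integer n ≥ 1, the identity Σ_{p=0}^{n-1} binom(n−1, p) · (p+1)^p · (n−p)^{n−p−2} = (n+1)^{n−1} holds, where the sum is taken in the rational numbers (so that the term with p = n−1 contributes (n)^{n-1}·1^{-1} = n^{n-1}, the exponent n−p−2 being interpreted as an integer exponent). -/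
open Polynomial in
lemma abel_poly (m : ℕ) :
    ∑ k ∈ Finset.range (m + 1),
      (C ((m.choose k : ℚ) * (((k : ℚ) + 1) ^ k / ((k : ℚ) + 1)))) *
        (X + C ((m : ℚ) - k)) ^ (m - k) = (X + C ((m : ℚ) + 1)) ^ m := by
  induction m with
  | zero => simp
  | succ m ih =>
    have hd : derivative (∑ k ∈ Finset.range (m + 1 + 1),
      (C (((m + 1).choose k : ℚ) * (((k : ℚ) + 1) ^ k / ((k : ℚ) + 1)))) *
        (X + C (((m + 1 : ℕ) : ℚ) - k)) ^ (m + 1 - k) -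
          (X + C (((m + 1 : ℕ) : ℚ) + 1)) ^ (m + 1)) = 0 := by
      have ih2 := congrArg (fun q : ℚ[X] => C ((m : ℚ) + 1) * q.comp (X + 1)) ih
      rw [derivative_sub, derivative_sum, Finset.sum_range_succ, sub_eq_zero]
      simp only [Polynomial.sum_comp, Finset.mul_sum] at ih2
      have hl : ∀ (a b : ℚ) (j : ℕ), derivative (C a * (X + C b) ^ j) =
          C (a * j) * (X + C b) ^ (j - 1) := by
        intro a b j
        simp [derivative_pow, mul_assoc]
      have hr : derivative ((X + C (((m + 1 : ℕ) : ℚ) + 1)) ^ (m + 1)) =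
          C ((m : ℚ) + 1) * ((X + C ((m : ℚ) + 1)) ^ m).comp (X + 1) := by
        have := hl 1 (((m + 1 : ℕ) : ℚ) + 1) (m + 1)
        rw [C_1, one_mul] at this
        rw [this]
        simp
        left
        congr 1
        ring
      rw [hr, ← ih2, hl]
      simp only [Nat.sub_self, Nat.cast_zero, mul_zero, C_0, zero_mul, add_zero]
      refine Finset.sum_congr rfl fun k hk => ?_
      have hk' : k ≤ m := by simpa [Nat.lt_succ_iff] using hk
      rw [hl, mul_comp, pow_comp, add_comp, X_comp, C_comp, C_comp, ← mul_assoc, ← C_mul]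
      congr 1
      · congr 1
        have h1 : ((m + 1).choose k : ℚ) * ((m + 1 - k : ℕ) : ℚ) = (m + 1) * m.choose k := by
          have := Nat.choose_mul_succ_eq m k
          have h2 : (m.choose k : ℚ) * (m + 1) = (m + 1).choose k * ((m + 1 - k : ℕ) : ℚ) := by
            exact_mod_cast this
          rw [← h2]; ring
        linear_combination (((k : ℚ) + 1) ^ k / ((k : ℚ) + 1)) * h1
      · rw [show m + 1 - k - 1 = m - k by omega]
        congr 1
        rw [add_assoc, ← C_1, ← C_add]
        congr 2
        push_cast; ring
    have hc := derivative_eq_zero.mp hd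
    rw [natDegree_eq_zero] at hc
    obtain ⟨c, hc⟩ := hc
    have he := congrArg (eval (-((m : ℚ) + 2))) hc
    rw [← sub_eq_zero, ← hc]
    have hz : c = 0 := by
      rw [eval_C] at he
      rw [he, eval_sub, eval_finsetSum]
      have hf := congrFun (fwdDiff_iter_pow_eq_zero_of_lt (R := ℚ) (Nat.lt_succ_self m)) 1
      rw [fwdDiff_iter_eq_sum_shift] at hf
      simp only [Pi.zero_apply] at hf
      have h0 : eval (-((m : ℚ) + 2)) ((X + C (((m + 1 : ℕ) : ℚ) + 1)) ^ (m + 1)) = 0 := by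
        simp
        ring
      rw [h0, sub_zero, ← hf]
      refine Finset.sum_congr rfl fun k hk => ?_
      have hk' : k ≤ m + 1 := by simpa [Nat.lt_succ_iff] using hk
      obtain ⟨j, hj⟩ := Nat.exists_eq_add_of_le hk'
      have hkne : (k : ℚ) + 1 ≠ 0 := by positivity
      simp only [eval_mul, eval_C, eval_pow, eval_add, eval_X, Nat.succ_eq_add_one, zsmul_eq_mul,
        nsmul_eq_mul, mul_one]
      rw [show m + 1 - k = j by omega,
        show -((m : ℚ) + 2) + (((m + 1 : ℕ) : ℚ) - k) = (-1) * ((k : ℚ) + 1) by push_cast; ring,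
        mul_pow]
      have hp : ((k : ℚ) + 1) ^ k * ((k : ℚ) + 1) ^ j = (1 + (k : ℚ)) ^ m * ((k : ℚ) + 1) := by
        rw [← pow_add, ← hj, pow_succ, add_comm (k : ℚ)]
      push_cast
      field_simp
      linear_combination ((m + 1).choose k : ℚ) * hp
    rw [hz, C_0]


/-- for every `n ≥ 1`,
`Σ_{p=0}^{n-1} binom(n−1,p) · (p+1)^p · (n−p)^{n−p−2} = (n+1)^{n−1}` in `ℚ`,
where the exponent `n − p − 2` is an integer exponent (so the term `p = n−1`
contributes `n^{n-1} · 1^{-1} = n^{n-1}`).  This is the case `x = y = 1` of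
Abel's formula. -/
theorem abel_special_case (n : ℕ) (hn : 1 ≤ n) :
    ∑ p ∈ Finset.range n,
        (Nat.choose (n - 1) p : ℚ) * ((p : ℚ) + 1) ^ p *
          ((n : ℚ) - (p : ℚ)) ^ ((n : ℤ) - (p : ℤ) - 2) =
      ((n : ℚ) + 1) ^ (n - 1) := by
  obtain ⟨m, rfl⟩ := Nat.exists_eq_add_of_le' hn
  have h := congrArg (Polynomial.eval (1 : ℚ)) (abel_poly m)
  rw [Polynomial.eval_finsetSum, ← Finset.sum_range_reflect] at h
  have hR : Polynomial.eval (1 : ℚ) ((Polynomial.X + Polynomial.C ((m : ℚ) + 1)) ^ m) =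
      (((m + 1 : ℕ) : ℚ) + 1) ^ (m + 1 - 1) := by
    simp
    ring
  rw [← hR, ← h]
  refine Finset.sum_congr rfl fun p hp => ?_
  have hp' : p ≤ m := by simpa [Nat.lt_succ_iff] using hp
  obtain ⟨j, rfl⟩ := Nat.exists_eq_add_of_le hp'
  have hj : (j : ℚ) + 1 ≠ 0 := by positivity
  rw [show p + j + 1 - 1 - p = j by omega, show p + j - j = p by omega,
    show p + j + 1 - 1 = p + j by omega,
    show ((p + j + 1 : ℕ) : ℚ) - p = (j : ℚ) + 1 by push_cast; ring,
    show ((p + j + 1 : ℕ) : ℤ) - p - 2 = (j : ℤ) - 1 by push_cast; ring,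
    zpow_sub_one₀ hj, zpow_natCast, ← Nat.choose_symm_add]
  simp only [Polynomial.eval_mul, Polynomial.eval_C, Polynomial.eval_pow, Polynomial.eval_add,
    Polynomial.eval_X]
  rw [show (1 : ℚ) + (((p + j : ℕ) : ℚ) - j) = p + 1 by push_cast; ring]
  ring
end

section
/- Let d : ℕ → ℕ be any sequence satisfying d(0) = 1 and, for all n ≥ 1, d(n) = Σ_{p=0}^{n-1} (p+1) · binom(n−1, p) · d(p) · d(n−1−p). Then d(n) = (n+1)^{n−1} for all n ≥ 1. -/
open Polynomial in
theorem abel_aux (m : ℕ) : ∀ a : ℚ,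
    ∑ q ∈ Finset.range (m + 1), (C ((m.choose q : ℚ) * ((q : ℚ) + 1) ^ (q - 1))) *
      (X + C (a + ((m - q : ℕ) : ℚ))) ^ (m - q) = (X + C (a + (m + 1))) ^ m := by
  induction m with
  | zero => intro a; simp
  | succ m ih =>
    intro a
    rw [← sub_eq_zero]
    set P : ℚ[X] := _ - _ with hP
    change P = 0
    have hd : derivative P = 0 := by
      rw [hP, derivative_sub, derivative_sum, Finset.sum_range_succ, sub_eq_zero]
      have h1 := congrArg (fun p => C ((m : ℚ) + 1) * p) (ih (a + 1))
      simp only [Finset.mul_sum] at h1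
      have h2 : derivative ((X + C (a + (((m + 1 : ℕ) : ℚ) + 1))) ^ (m + 1)) =
          C ((m : ℚ) + 1) * (X + C (a + 1 + (m + 1))) ^ m := by
        rw [derivative_X_add_C_pow]
        simp only [Nat.add_sub_cancel]
        push_cast
        rw [show a + ((m : ℚ) + 1 + 1) = a + 1 + (m + 1) by ring]
      rw [h2, ← h1]
      simp only [Nat.sub_self, pow_zero, mul_one, derivative_C, add_zero]
      apply Finset.sum_congr rfl
      intro q hq
      have hq' : q ≤ m := by simpa [Nat.lt_succ_iff] using hq
      rw [derivative_C_mul, derivative_X_add_C_pow, ← mul_assoc, ← mul_assoc,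
        ← C_mul, ← C_mul]
      have e : m + 1 - q = (m - q) + 1 := by omega
      have hc : (m.choose q : ℚ) * (m + 1) = ((m + 1).choose q : ℚ) * ((m - q : ℕ) + 1) := by
        have := Nat.choose_mul_succ_eq m q
        rw [e] at this
        exact_mod_cast this
      rw [e]
      rw [Nat.add_sub_cancel]
      have e1 : ((m + 1).choose q : ℚ) * ((q : ℚ) + 1) ^ (q - 1) * ((m - q + 1 : ℕ) : ℚ) =
          ((m : ℚ) + 1) * ((m.choose q : ℚ) * ((q : ℚ) + 1) ^ (q - 1)) := by
        rw [Nat.cast_add, Nat.cast_one]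
        linear_combination (-((q : ℚ) + 1) ^ (q - 1)) * hc
      have e2 : a + ((m - q + 1 : ℕ) : ℚ) = a + 1 + ((m - q : ℕ) : ℚ) := by
        rw [Nat.cast_add, Nat.cast_one]
        ring
      rw [e1, e2]
    have he : P.eval (-(a + (m + 1) + 1)) = 0 := by
      have h := congrFun (fwdDiff_iter_pow_eq_zero_of_lt (R := ℚ) (Nat.lt_succ_self m)) 1
      rw [fwdDiff_iter_eq_sum_shift] at h
      rw [hP, eval_sub, eval_finsetSum]
      simp only [eval_mul, eval_C, eval_pow, eval_add, eval_X]
      rw [show -(a + ((m:ℚ) + 1) + 1) + (a + (((m + 1 : ℕ) : ℚ) + 1)) = 0 by push_cast; ring,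
        zero_pow (Nat.succ_ne_zero m), sub_zero]
      simp only [Pi.zero_apply] at h
      rw [← h]
      apply Finset.sum_congr rfl
      intro q hq
      have hq' : q ≤ m + 1 := by simpa [Nat.lt_succ_iff] using hq
      rw [Nat.cast_sub hq']
      rw [show -(a + ((m:ℚ) + 1) + 1) + (a + (((m + 1 : ℕ) : ℚ) - q)) = (-1) * ((q:ℚ) + 1) by
        push_cast; ring, mul_pow]
      have hp : ((q:ℚ) + 1) ^ (q - 1) * ((q:ℚ) + 1) ^ (m + 1 - q) = (1 + (q:ℚ)) ^ m := by
        rcases Nat.eq_zero_or_pos q with rfl | h0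
        · simp
        · rw [← pow_add, add_comm (q:ℚ)]
          congr 1
          omega
      simp only [smul_eq_mul, zsmul_eq_mul, nsmul_eq_mul, mul_one]
      rw [← hp]
      push_cast
      ring
    have hn := derivative_eq_zero.mp hd
    rw [eq_C_of_natDegree_eq_zero hn] at he ⊢
    simpa using he

theorem abel_nat (m : ℕ) : ∑ p ∈ Finset.range (m + 1),
    (p + 1) * m.choose p * (p + 1) ^ (p - 1) * (m - p + 1) ^ (m - p - 1) = (m + 2) ^ m := by
  have h := congrArg (Polynomial.eval 0) (abel_aux m 1)
  rw [Polynomial.eval_finsetSum] at h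
  simp only [Polynomial.eval_mul, Polynomial.eval_C, Polynomial.eval_pow, Polynomial.eval_add,
    Polynomial.eval_X] at h
  rw [← Finset.sum_range_reflect]
  have h' : (∑ q ∈ Finset.range (m + 1), m.choose q * (q + 1) ^ (q - 1) *
      (0 + (1 + (m - q))) ^ (m - q)) = (0 + (1 + (m + 1))) ^ m := by exact_mod_cast h
  rw [show m + 2 = 0 + (1 + (m + 1)) by ring, ← h']
  apply Finset.sum_congr rfl
  intro q hq
  have hq' : q ≤ m := by simpa [Nat.lt_succ_iff] using hq
  rw [show m + 1 - 1 - q = m - q by omega, Nat.choose_symm hq', show m - (m - q) = q by omega]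
  have : (m - q + 1) * (m - q + 1) ^ (m - q - 1) = (0 + (1 + (m - q))) ^ (m - q) := by
    rw [show 0 + (1 + (m - q)) = m - q + 1 by ring]
    rcases Nat.eq_zero_or_pos (m - q) with h0 | h0
    · simp [h0]
    · rw [← pow_succ']
      congr 1
      omega
  rw [← this]
  ring

/-- any sequence `d : ℕ → ℕ` with `d 0 = 1` satisfying the
recursion `d n = Σ_{p=0}^{n-1} (p+1) · binom(n−1,p) · d p · d (n−1−p)` for all
`n ≥ 1` satisfies `d n = (n+1)^{n−1}` for all `n ≥ 1`. -/
theorem recursion_gives_parking_count (d : ℕ → ℕ) (h0 : d 0 = 1)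
    (hrec : ∀ n, 1 ≤ n →
      d n = ∑ p ∈ Finset.range n, (p + 1) * Nat.choose (n - 1) p * d p * d (n - 1 - p)) :
    ∀ n, 1 ≤ n → d n = (n + 1) ^ (n - 1) := by
  have key : ∀ n, d n = (n + 1) ^ (n - 1) := by
    intro n
    induction n using Nat.strong_induction_on with
    | _ n ih =>
      rcases n with _ | m
      · simpa using h0
      · rw [hrec (m + 1) (by omega), Nat.add_sub_cancel, show m + 1 + 1 = m + 2 by ring,
          ← abel_nat m]
        apply Finset.sum_congr rfl
        intro p hp
        have hp' := Finset.mem_range.mp hp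
        rw [ih p hp', ih (m - p) (by omega)]
  intro n _
  exact key n
end

section
/- Let t be a planar binary rooted tree with n internal vertices (hence n+1 leaves), and for each internal vertex i of t let a_i be the number of leaves of the subtree at i lying to the left of vertex i and b_i the number of leaves of that subtree lying to the right. Then Σ_{i=1}^{n} a_i · b_i = n(n+1)/2. Equivalently, defining S recursively on binary trees by S(leaf) = 0 and S(t₁ ∧ t₂) = S(t₁) + S(t₂) + ℓ(t₁)·ℓ(t₂), where ℓ(t) is the number of leaves of t and t₁ ∧ t₂ is the grafting of t₁ and t₂ at a new root, every binary tree t with n internal vertices satisfies S(t) = n(n+1)/2. -/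
/-- Planar binary rooted trees: either a single leaf, or the grafting of two
planar binary rooted trees at a new root vertex. -/
inductive PlanarBinaryTree where
  | leaf : PlanarBinaryTree
  | node : PlanarBinaryTree → PlanarBinaryTree → PlanarBinaryTree

namespace PlanarBinaryTree

/-- Number of leaves of a planar binary rooted tree. -/
def numLeaves : PlanarBinaryTree → ℕ
  | leaf => 1
  | node l r => numLeaves l + numLeaves r

/-- Number of internal vertices of a planar binary rooted tree. -/
def numInternal : PlanarBinaryTree → ℕ
  | leaf => 0
  | node l r => numInternal l + numInternal r + 1

/-- `S(t) = Σ_i a_i · b_i`: the sum, over the internal vertices `i` of `t`, of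
the product of the number of leaves of the subtree at `i` lying to the left of
`i` with the number lying to the right; recursively, `S(leaf) = 0` and
`S(t₁ ∧ t₂) = S(t₁) + S(t₂) + ℓ(t₁)·ℓ(t₂)`. -/
def S : PlanarBinaryTree → ℕ
  | leaf => 0
  | node l r => S l + S r + numLeaves l * numLeaves r

end PlanarBinaryTree

theorem PlanarBinaryTree.numLeaves_eq_aux (t : PlanarBinaryTree) :
    t.numLeaves = t.numInternal + 1 := by
  induction t with
  | leaf => rfl
  | node l r hl hr =>
    simp only [PlanarBinaryTree.numLeaves, PlanarBinaryTree.numInternal, hl, hr]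
    ring

theorem PlanarBinaryTree.two_mul_S_aux (t : PlanarBinaryTree) :
    t.numInternal * (t.numInternal + 1) = 2 * t.S := by
  induction t with
  | leaf => rfl
  | node l r hl hr =>
    simp only [PlanarBinaryTree.S, PlanarBinaryTree.numInternal,
      PlanarBinaryTree.numLeaves_eq_aux]
    linarith

/-- for a planar binary rooted tree with `n` internal vertices,
`Σ_{i=1}^{n} a_i b_i = n(n+1)/2`; i.e. the point `M(t)` lies on the hyperplane
`x_1 + ⋯ + x_n = n(n+1)/2`. -/
theorem planarBinaryTree_S_eq (t : PlanarBinaryTree) :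
    t.S = t.numInternal * (t.numInternal + 1) / 2 := by
  rw [PlanarBinaryTree.two_mul_S_aux]
  omega
end

section
/- For every integer n ≥ 0 and all real (or rational) x ≠ 0 and y, Abel's formula holds: x^{-1}(x + y + n)^n = Σ_{k=0}^{n} binom(n, k) (x + k)^{k-1} (y + n − k)^{n−k}, where for k = 0 the factor (x+0)^{-1} is interpreted as 1/x and the formula is understood under the additional hypothesis that x + k ≠ 0 for all 0 ≤ k ≤ n. -/
/-- The vanishing alternating sum (finite differences of a polynomial of low degree). -/
theorem abel_aux_zero (n : ℕ) (x : ℝ) :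
    ∑ k ∈ Finset.range (n + 2),
      ((-1 : ℝ) ^ (n + 1 - k) * ((n + 1).choose k : ℝ)) * (x + (k : ℝ)) ^ n = 0 := by
  have h1 := fwdDiff_iter_eq_sum_shift (1 : ℝ) (fun r : ℝ => r ^ n) (n + 1) x
  have h2 : (fwdDiff (1 : ℝ))^[n + 1] (fun r : ℝ => r ^ n) = 0 :=
    fwdDiff_iter_pow_eq_zero_of_lt (Nat.lt_succ_self n)
  rw [h2] at h1
  simp only [Pi.zero_apply] at h1
  rw [h1]
  refine Finset.sum_congr rfl fun k _ => ?_
  simp [zsmul_eq_mul]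

/-- Abel's formula. For `n ≥ 0` and real `x ≠ 0`, `y`, with
`x + k ≠ 0` for all `0 ≤ k ≤ n`,
`x⁻¹ (x+y+n)^n = Σ_{k=0}^{n} binom(n,k) (x+k)^{k-1} (y+n−k)^{n−k}`,
the exponent `k − 1` being an integer exponent (negative only for `k = 0`). -/
theorem abel_formula (n : ℕ) (x y : ℝ) (hx : x ≠ 0)
    (h : ∀ k : ℕ, k ≤ n → x + (k : ℝ) ≠ 0) :
    x⁻¹ * (x + y + (n : ℝ)) ^ n =
      ∑ k ∈ Finset.range (n + 1),
        (Nat.choose n k : ℝ) * (x + (k : ℝ)) ^ ((k : ℤ) - 1) *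
          (y + (n : ℝ) - (k : ℝ)) ^ (n - k) := by
  induction n generalizing y with
  | zero => simp
  | succ n ih =>
    have ih' := fun y => ih y (fun k hk => h k (by omega))
    let F : ℝ → ℝ := fun y => (∑ k ∈ Finset.range (n + 1 + 1),
        (Nat.choose (n + 1) k : ℝ) * (x + (k : ℝ)) ^ ((k : ℤ) - 1) *
          (y + ((n + 1 : ℕ) : ℝ) - (k : ℝ)) ^ (n + 1 - k)) -
        x⁻¹ * (x + y + ((n + 1 : ℕ) : ℝ)) ^ (n + 1)
    have hF : ∀ y, HasDerivAt F 0 y := by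
      intro y
      have hs : HasDerivAt F ((∑ k ∈ Finset.range (n + 1 + 1),
          (Nat.choose (n + 1) k : ℝ) * (x + (k : ℝ)) ^ ((k : ℤ) - 1) *
          (((n + 1 - k : ℕ) : ℝ) * (y + ((n + 1 : ℕ) : ℝ) - (k : ℝ)) ^ (n + 1 - k - 1) * 1)) -
          x⁻¹ * (((n + 1 : ℕ) : ℝ) * (x + y + ((n + 1 : ℕ) : ℝ)) ^ (n + 1 - 1) * 1)) y := by
        apply HasDerivAt.sub
        · apply HasDerivAt.fun_sum
          intro k _
          exact ((((hasDerivAt_id y).add_const _).sub_const _).pow _).const_mul _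
        · exact ((((hasDerivAt_id y).const_add x).add_const _).pow _).const_mul _
      convert hs using 1
      rw [Finset.sum_range_succ]
      have e : x⁻¹ * (((n + 1 : ℕ) : ℝ) * (x + y + ((n + 1 : ℕ) : ℝ)) ^ (n + 1 - 1) * 1)
          = ((n + 1 : ℕ) : ℝ) * (x⁻¹ * (x + (y + 1) + (n : ℝ)) ^ n) := by
        push_cast
        rw [show x + y + ((n : ℝ) + 1) = x + (y + 1) + n by ring]
        ring
      rw [e, ih' (y + 1), Finset.mul_sum]
      simp only [Nat.sub_self, Nat.cast_zero, zero_mul, mul_zero, add_zero]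
      symm
      rw [sub_eq_zero]
      refine Finset.sum_congr rfl fun k hk => ?_
      have hk' : k ≤ n := by simpa [Nat.lt_succ_iff] using hk
      have c : ((n + 1).choose k : ℝ) * ((n + 1 - k : ℕ) : ℝ) = ((n + 1 : ℕ) : ℝ) * (n.choose k : ℝ) := by
        have := Nat.choose_mul_succ_eq n k
        rw [mul_comm ((n + 1 : ℕ) : ℝ)]
        exact_mod_cast this.symm
      rw [show n + 1 - k - 1 = n - k by omega,
        show y + ((n + 1 : ℕ) : ℝ) - (k : ℝ) = y + 1 + n - k by push_cast; ring]
      linear_combination (x + (k : ℝ)) ^ ((k : ℤ) - 1) * (y + 1 + n - k) ^ (n - k) * c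
    have hc : F y = F (-x - ((n + 1 : ℕ) : ℝ)) :=
      is_const_of_deriv_eq_zero (fun y => (hF y).differentiableAt) (fun y => (hF y).deriv) _ _
    have h0 : F (-x - ((n + 1 : ℕ) : ℝ)) = 0 := by
      simp only [F]
      rw [show x + (-x - ((n + 1 : ℕ) : ℝ)) + ((n + 1 : ℕ) : ℝ) = 0 by ring,
        zero_pow (Nat.succ_ne_zero n), mul_zero, sub_zero, ← abel_aux_zero n x]
      refine Finset.sum_congr rfl fun k hk => ?_
      have hk' : k ≤ n + 1 := by
        have := Finset.mem_range.1 hk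
        omega
      have hne := h k hk'
      rw [show -x - ((n + 1 : ℕ) : ℝ) + ((n + 1 : ℕ) : ℝ) - (k : ℝ) = (-1) * (x + k) by ring,
        mul_pow]
      have p : (x + (k : ℝ)) ^ ((k : ℤ) - 1) * (x + (k : ℝ)) ^ (n + 1 - k) = (x + (k : ℝ)) ^ n := by
        rw [← zpow_natCast, ← zpow_natCast, ← zpow_add₀ hne]
        congr 1
        omega
      rw [← p]
      ring
    have hfin : F y = 0 := hc.trans h0
    exact (sub_eq_zero.1 hfin).symm
end
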